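/- Let N ≥ 3, 2* = 2N/(N−2), and let (u_k)_{k∈ℕ} be a sequence in C_c^∞(ℝ^N) with sup_k ∫_{ℝ^N}(|∇u_k|² + u_k²) dx < ∞. Assume that for every sequence of points (y_k) in ℝ^N and every sequence of positive reals (t_k) with t_k → 0 one has t_k^{(N−2)/2} u_k(y_k + t_k ξ) → 0 for almost every ξ ∈ ℝ^N, and assume that ∫_{ℝ^N} |u_k|^p dx → 0 for some p ∈ (2, 2*). Then ∫_{ℝ^N} |u_k|^{2*} dx → 0 as k → ∞. -/

import Mathlib

open MeasureTheory Filter Topology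
open scoped RealInnerProductSpace

noncomputable section

section Auxiliary

open SchwartzMap FourierTransform Set
open scoped ENNReal NNReal

section Fourier

variable {V : Type*} [NormedAddCommGroup V] [InnerProductSpace ℝ V] [FiniteDimensional ℝ V]
  [MeasurableSpace V] [BorelSpace V]

/-- Plancherel's theorem for Schwartz functions, as an identity of Lebesgue integrals. -/
lemma lintegral_fourier_sq (f : 𝓢(V, ℂ)) :
    ∫⁻ ξ, ENNReal.ofReal (‖𝓕 f ξ‖ ^ 2) = ∫⁻ x, ENNReal.ofReal (‖f x‖ ^ 2) := by
  have key (g : 𝓢(V, ℂ)) : Integrable (fun x ↦ ‖g x‖ ^ 2) :=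
    (g.memLp 2 volume).integrable_norm_pow (by simp)
  rw [← ofReal_integral_eq_lintegral_ofReal (key _) (.of_forall fun _ ↦ by positivity),
    ← ofReal_integral_eq_lintegral_ofReal (key _) (.of_forall fun _ ↦ by positivity),
    integral_norm_sq_fourier]

/-- If `g` is bounded by half the level `l` and the Fourier transforms of `f` and `g` agree
off `A`, then `{l < ‖f‖}` is controlled by the energy of `𝓕 f` on `A`. -/
lemma volume_lt_norm_le (f g : 𝓢(V, ℂ)) {l : ℝ} (hl : 0 < l) (hg : ∀ x, ‖g x‖ ≤ l / 2)
    (A : Set V) (hA : ∀ ξ, ‖𝓕 f ξ - 𝓕 g ξ‖ ≤ A.indicator (fun ξ ↦ ‖𝓕 f ξ‖) ξ) :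
    volume {x | l < ‖f x‖} ≤ ENNReal.ofReal (4 * l ^ (-2 : ℝ)) *
      ∫⁻ ξ, A.indicator (fun ξ ↦ ENNReal.ofReal (‖𝓕 f ξ‖ ^ 2)) ξ := by
  obtain ⟨h, hfg, hFfg⟩ :
      ∃ h : 𝓢(V, ℂ), (∀ x, h x = f x - g x) ∧ ∀ ξ, 𝓕 h ξ = 𝓕 f ξ - 𝓕 g ξ :=
    ⟨f - g, fun x ↦ rfl, fun ξ ↦ by
      rw [sub_eq_add_neg, FourierTransform.fourier_add, FourierTransform.fourier_neg,
        ← sub_eq_add_neg, sub_apply]⟩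
  have hsub : {x | l < ‖f x‖} ⊆
      {x | ENNReal.ofReal (l ^ 2 / 4) ≤ ENNReal.ofReal (‖h x‖ ^ 2)} := by
    intro x hx
    apply ENNReal.ofReal_le_ofReal
    have h1 : l / 2 ≤ ‖h x‖ := by
      have := norm_sub_norm_le (f x) (g x)
      have := hg x
      simp only [mem_ofPred_eq] at hx
      rw [hfg]
      linarith
    nlinarith
  have hE : ∫⁻ x, ENNReal.ofReal (‖h x‖ ^ 2) ≤
      ∫⁻ ξ, A.indicator (fun ξ ↦ ENNReal.ofReal (‖𝓕 f ξ‖ ^ 2)) ξ := by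
    rw [← lintegral_fourier_sq]
    refine lintegral_mono fun ξ ↦ ?_
    have hξA := hA ξ
    simp only [hFfg]
    by_cases hξ : ξ ∈ A
    · simp only [hξ, indicator_of_mem] at hξA ⊢
      gcongr
    · simp only [hξ, not_false_eq_true, indicator_of_notMem] at hξA ⊢
      simp [le_antisymm hξA (norm_nonneg _)]
  have hmeas : Measurable fun x ↦ ENNReal.ofReal (‖h x‖ ^ 2) := by
    have := h.continuous.measurable
    fun_prop
  have hm := mul_meas_ge_le_lintegral₀ (μ := volume) hmeas.aemeasurable
    (ENNReal.ofReal (l ^ 2 / 4))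
  calc volume {x | l < ‖f x‖}
      ≤ volume {x | ENNReal.ofReal (l ^ 2 / 4) ≤ ENNReal.ofReal (‖h x‖ ^ 2)} :=
        measure_mono hsub
    _ = ENNReal.ofReal (4 * l ^ (-2 : ℝ)) * (ENNReal.ofReal (l ^ 2 / 4) *
        volume {x | ENNReal.ofReal (l ^ 2 / 4) ≤ ENNReal.ofReal (‖h x‖ ^ 2)}) := by
        have : 4 * l ^ (-2 : ℝ) * (l ^ 2 / 4) = 1 := by
          rw [Real.rpow_neg hl.le, Real.rpow_two]
          field_simp
        rw [← mul_assoc, ← ENNReal.ofReal_mul (by positivity), this, ENNReal.ofReal_one, one_mul]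
    _ ≤ _ := by gcongr; exact hm.trans hE

lemma lintegral_Ioi_indicator_rpow {s c : ℝ} (hs : 0 < s) (hc : 0 ≤ c) :
    ∫⁻ l in Ioi (0 : ℝ), (Iio c).indicator (fun l ↦ ENNReal.ofReal (l ^ (s - 1))) l =
      ENNReal.ofReal (c ^ s / s) := by
  rw [lintegral_indicator measurableSet_Iio, Measure.restrict_restrict measurableSet_Iio,
    Iio_inter_Ioi, restrict_Ioo_eq_restrict_Ioc, ← ofReal_integral_eq_lintegral_ofReal]
  · rw [← intervalIntegral.integral_of_le hc, integral_rpow (.inl (by linarith))]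
    simp [Real.zero_rpow hs.ne']
  · exact (intervalIntegrable_iff_integrableOn_Ioc_of_le hc).1
      (intervalIntegral.intervalIntegrable_rpow' (by linarith))
  · exact (ae_restrict_mem measurableSet_Ioc).mono fun l hl ↦ Real.rpow_nonneg hl.1.le _

/-- Refined Sobolev inequality: if the smoothings `g t` of `f` are bounded by `ε t ^ (-a)` and
retain all frequencies up to `1 / t`, then the `L^q` norm of `f` is controlled by `ε` and a
homogeneous Sobolev norm. -/
theorem lintegral_rpow_le_of_smoothing (f : 𝓢(V, ℂ)) (g : ℝ → 𝓢(V, ℂ)) {a q ε : ℝ} (ha : 0 < a)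
    (hq : 2 < q) (hε : 0 < ε) (hg : ∀ t, 0 < t → ∀ x, ‖g t x‖ ≤ ε * t ^ (-a))
    (hA : ∀ t, 0 < t → ∀ ξ,
      ‖𝓕 f ξ - 𝓕 (g t) ξ‖ ≤ {ξ | 1 < t * ‖ξ‖}.indicator (fun ξ ↦ ‖𝓕 f ξ‖) ξ) :
    ∫⁻ x, ENNReal.ofReal (‖f x‖ ^ q) ≤
      ENNReal.ofReal (4 * q / (q - 2) * (2 * ε) ^ (q - 2)) *
        ∫⁻ ξ, ENNReal.ofReal (‖ξ‖ ^ (a * (q - 2)) * ‖𝓕 f ξ‖ ^ 2) := by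
  have hweak (l : ℝ) (hl : l ∈ Ioi (0 : ℝ)) : volume {x | l < ‖f x‖} ≤
      ENNReal.ofReal (4 * l ^ (-2 : ℝ)) * ∫⁻ ξ,
        {ξ | l < 2 * ε * ‖ξ‖ ^ a}.indicator (fun ξ ↦ ENNReal.ofReal (‖𝓕 f ξ‖ ^ 2)) ξ := by
    have hl : 0 < l := hl
    set t := (2 * ε / l) ^ a⁻¹ with ht
    have ht0 : 0 < t := by positivity
    have hta : t ^ a = 2 * ε / l := Real.rpow_inv_rpow (by positivity) ha.ne'
    have hset : {ξ : V | 1 < t * ‖ξ‖} ⊆ {ξ | l < 2 * ε * ‖ξ‖ ^ a} := by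
      intro ξ hξ
      have h := Real.one_lt_rpow hξ ha
      rw [Real.mul_rpow ht0.le (norm_nonneg _), hta, div_mul_eq_mul_div, one_lt_div hl] at h
      exact h
    refine (volume_lt_norm_le f (g t) hl (fun x ↦ (hg t ht0 x).trans_eq ?_) _ (hA t ht0)).trans ?_
    · rw [Real.rpow_neg ht0.le, hta]; field_simp
    · gcongr
  have hmeas : Measurable fun z : ℝ × V ↦ (if z.1 < 2 * ε * ‖z.2‖ ^ a then
      ENNReal.ofReal (4 * z.1 ^ (q - 2 - 1)) * ENNReal.ofReal (‖𝓕 f z.2‖ ^ 2) else 0) := by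
    refine Measurable.ite (measurableSet_lt (by fun_prop) (by fun_prop)) ?_ measurable_const
    have := (𝓕 f).continuous.measurable
    fun_prop
  rw [lintegral_rpow_eq_lintegral_meas_lt_mul volume (.of_forall fun _ ↦ norm_nonneg _)
    f.continuous.norm.measurable.aemeasurable (by linarith)]
  calc _ ≤ ENNReal.ofReal q * ∫⁻ l in Ioi (0 : ℝ), ∫⁻ ξ, (if l < 2 * ε * ‖ξ‖ ^ a then
      ENNReal.ofReal (4 * l ^ (q - 2 - 1)) * ENNReal.ofReal (‖𝓕 f ξ‖ ^ 2) else 0) := by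
        gcongr ENNReal.ofReal q * ?_
        refine setLIntegral_mono' measurableSet_Ioi fun l hl ↦ ?_
        refine (mul_le_mul_left (hweak l hl) _).trans_eq ?_
        have hl : 0 < l := hl
        rw [mul_right_comm, ← ENNReal.ofReal_mul (by positivity), mul_assoc 4,
          ← Real.rpow_add hl, ← lintegral_const_mul' _ _ ENNReal.ofReal_ne_top]
        refine lintegral_congr fun ξ ↦ ?_
        rw [show -2 + (q - 1) = q - 2 - 1 by ring]
        simp [indicator_apply]
    _ = ENNReal.ofReal q * ∫⁻ ξ, ∫⁻ l in Ioi (0 : ℝ), (if l < 2 * ε * ‖ξ‖ ^ a then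
      ENNReal.ofReal (4 * l ^ (q - 2 - 1)) * ENNReal.ofReal (‖𝓕 f ξ‖ ^ 2) else 0) := by
        rw [lintegral_lintegral_swap hmeas.aemeasurable]
    _ = _ := by
        rw [← lintegral_const_mul' _ _ ENNReal.ofReal_ne_top,
          ← lintegral_const_mul' _ _ ENNReal.ofReal_ne_top]
        refine lintegral_congr fun ξ ↦ ?_
        have h1 : ∀ l : ℝ, (if l < 2 * ε * ‖ξ‖ ^ a then
            ENNReal.ofReal (4 * l ^ (q - 2 - 1)) * ENNReal.ofReal (‖𝓕 f ξ‖ ^ 2) else 0) =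
            ENNReal.ofReal (4 * ‖𝓕 f ξ‖ ^ 2) * (Iio (2 * ε * ‖ξ‖ ^ a)).indicator
              (fun l ↦ ENNReal.ofReal (l ^ (q - 2 - 1))) l := by
          intro l
          by_cases h : l < 2 * ε * ‖ξ‖ ^ a
          · simp only [h, if_true, mem_Iio, indicator_of_mem]
            rw [ENNReal.ofReal_mul (by norm_num), ENNReal.ofReal_mul (by norm_num)]
            ring
          · simp [h]
        simp_rw [h1]
        rw [lintegral_const_mul' _ _ ENNReal.ofReal_ne_top,
          lintegral_Ioi_indicator_rpow (by linarith) (by positivity),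
          ← ENNReal.ofReal_mul (by positivity), ← ENNReal.ofReal_mul (by positivity),
          ← ENNReal.ofReal_mul (mul_nonneg (div_nonneg (by linarith) (by linarith))
            (by positivity)),
          Real.mul_rpow (by positivity) (by positivity), ← Real.rpow_mul (norm_nonneg _)]
        congr 1
        ring

end Fourier

section Smoothing

variable {V : Type*} [NormedAddCommGroup V] [InnerProductSpace ℝ V] [FiniteDimensional ℝ V]
  [MeasurableSpace V] [BorelSpace V]

/-- A dilated Fourier multiplier acts as averaging against the dilated Fourier transform. -/
lemma fourierInv_dilated_multiplier_apply (f M : 𝓢(V, ℂ)) {t : ℝ} (ht : 0 < t) (x : V) :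
    𝓕⁻ (smulLeftCLM ℂ (fun ξ ↦ M (t • ξ)) (𝓕 f)) x = ∫ z, 𝓕 M z * f (x + t • z) := by
  have hM : (fun ξ ↦ M (t • ξ)).HasTemperateGrowth := by fun_prop
  have hMt : Integrable (fun ξ ↦ M (t • ξ)) := M.integrable.comp_smul ht.ne'
  set φ : V → ℂ := fun ξ ↦ Real.fourierChar (inner ℝ ξ x) • M (t • ξ) with hφ
  have hφi : Integrable φ := by
    refine hMt.norm.mono' ?_ (.of_forall fun ξ ↦ by simp [hφ])
    have := M.continuous
    have := Real.continuous_fourierChar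
    exact (by fun_prop : Continuous φ).aestronglyMeasurable
  have h1 : ∫ ξ, 𝓕 f ξ * φ ξ = ∫ w, f w * 𝓕 φ w := by
    simpa using! VectorFourier.integral_bilin_fourierIntegral_eq_flip (.mul ℂ ℂ) (L := innerₗ V)
      Real.continuous_fourierChar continuous_inner f.integrable hφi
  have h2 (z : V) : 𝓕 φ (x + t • z) = ((t ^ Module.finrank ℝ V)⁻¹ : ℝ) • 𝓕 M z := by
    have h := Measure.integral_comp_smul volume
      (fun η : V ↦ Real.fourierChar (-inner ℝ η z) • M η) t
    rw [abs_of_pos (by positivity)] at h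
    rw [fourier_coe, Real.fourier_eq, Real.fourier_eq, ← h]
    refine integral_congr_ae (.of_forall fun ξ ↦ ?_)
    simp only [hφ, smul_smul, ← AddChar.map_add_eq_mul, inner_add_right, inner_smul_right,
      inner_smul_left]
    congr 2
    simp
  have h3 := Measure.integral_comp_smul volume (fun w ↦ f (x + w) * 𝓕 φ (x + w)) t
  rw [abs_of_pos (by positivity), integral_add_left_eq_self (fun w ↦ f w * 𝓕 φ w)] at h3
  rw [fourierInv_coe, Real.fourierInv_eq]
  calc _ = ∫ ξ, 𝓕 f ξ * φ ξ := by
        refine integral_congr_ae (.of_forall fun ξ ↦ ?_)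
        simp only [hφ, smulLeftCLM_apply_apply hM, smul_eq_mul, Circle.smul_def]
        ring
    _ = _ := by
        rw [h1]
        simp only [h2, mul_smul_comm, integral_smul] at h3
        have hc : ((t ^ Module.finrank ℝ V)⁻¹ : ℝ) ≠ 0 := by positivity
        rw [← (smul_right_injective ℂ hc).eq_iff.1 h3]
        simp_rw [mul_comm]

/-- The homogeneous Sobolev energy of a smooth function on the Fourier side. -/
lemma lintegral_norm_sq_mul_fourier_sq {u : V → ℝ} {f : 𝓢(V, ℂ)} (hu : Differentiable ℝ u)
    (hf : ∀ x, f x = u x) :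
    ∫⁻ ξ, ENNReal.ofReal (‖ξ‖ ^ 2 * ‖𝓕 f ξ‖ ^ 2) ≤
      ∫⁻ x, ENNReal.ofReal (‖gradient u x‖ ^ 2) := by
  let b := stdOrthonormalBasis ℝ V
  have hder (m x : V) : ‖LineDeriv.lineDerivOp m f x‖ = ‖(inner ℝ (gradient u x) m : ℝ)‖ := by
    have h1 : HasFDerivAt f (Complex.ofRealCLM ∘L fderiv ℝ u x) x := by
      rw [show (f : V → ℂ) = Complex.ofRealCLM ∘ u from funext hf]
      exact Complex.ofRealCLM.hasFDerivAt.comp x (hu x).hasFDerivAt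
    rw [SchwartzMap.lineDerivOp_apply_eq_fderiv, h1.fderiv, ← toDual_gradient]
    simp
  have hfour (m ξ : V) : ‖(inner ℝ ξ m : ℝ)‖ ^ 2 * ‖𝓕 f ξ‖ ^ 2 ≤
      ‖𝓕 (LineDeriv.lineDerivOp m f) ξ‖ ^ 2 := by
    have hm : (inner ℝ · m).HasTemperateGrowth := by fun_prop
    rw [fourier_lineDerivOp_eq, smul_apply, smulLeftCLM_apply_apply hm, ← mul_pow]
    simp only [norm_smul, norm_mul, Complex.norm_I, Complex.norm_ofNat, Complex.norm_real]
    refine pow_le_pow_left₀ (by positivity) (le_mul_of_one_le_left (by positivity) ?_) 2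
    rw [Real.norm_of_nonneg Real.pi_pos.le]
    linarith [Real.pi_gt_three]
  calc _ = ∫⁻ ξ, ∑ i, ENNReal.ofReal (‖(inner ℝ ξ (b i) : ℝ)‖ ^ 2 * ‖𝓕 f ξ‖ ^ 2) := by
        refine lintegral_congr fun ξ ↦ ?_
        rw [← ENNReal.ofReal_sum_of_nonneg (fun _ _ ↦ by positivity), ← Finset.sum_mul,
          b.sum_sq_norm_inner_left]
    _ ≤ ∫⁻ ξ, ∑ i, ENNReal.ofReal (‖𝓕 (LineDeriv.lineDerivOp (b i) f) ξ‖ ^ 2) := by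
        gcongr with ξ i
        exact hfour _ _
    _ = ∑ i, ∫⁻ ξ, ENNReal.ofReal (‖𝓕 (LineDeriv.lineDerivOp (b i) f) ξ‖ ^ 2) := by
        refine lintegral_finsetSum _ fun i _ ↦ ?_
        have := (𝓕 (LineDeriv.lineDerivOp (b i) f)).continuous.measurable
        fun_prop
    _ = ∑ i, ∫⁻ x, ENNReal.ofReal (‖LineDeriv.lineDerivOp (b i) f x‖ ^ 2) := by
        simp_rw [lintegral_fourier_sq]
    _ = ∫⁻ x, ∑ i, ENNReal.ofReal (‖LineDeriv.lineDerivOp (b i) f x‖ ^ 2) := by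
        refine (lintegral_finsetSum _ fun i _ ↦ ?_).symm
        have := (LineDeriv.lineDerivOp (b i) f).continuous.measurable
        fun_prop
    _ = _ := by
        refine lintegral_congr fun x ↦ ?_
        rw [← ENNReal.ofReal_sum_of_nonneg (fun _ _ ↦ by positivity)]
        simp_rw [hder]
        rw [b.sum_sq_norm_inner_left]

/-- Refined Sobolev inequality: the `L^q` norm of a test function is controlled by its gradient
and by the size of its averages at all scales against a fixed Schwartz kernel. -/
theorem exists_kernel_lintegral_rpow_le (V : Type*) [NormedAddCommGroup V]
    [InnerProductSpace ℝ V] [FiniteDimensional ℝ V] [MeasurableSpace V] [BorelSpace V] :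
    ∃ K : 𝓢(V, ℂ), ∀ (u : V → ℝ), ContDiff ℝ (⊤ : ℕ∞) u → HasCompactSupport u →
      ∀ a q ε : ℝ, 0 < a → 2 < q → a * (q - 2) = 2 → 0 < ε →
      (∀ t, 0 < t → ∀ x, t ^ a * ‖∫ z, K z * (u (x + t • z) : ℂ)‖ ≤ ε) →
      ∫⁻ x, ENNReal.ofReal (|u x| ^ q) ≤
        ENNReal.ofReal (4 * q / (q - 2) * (2 * ε) ^ (q - 2)) *
          ∫⁻ x, ENNReal.ofReal (‖gradient u x‖ ^ 2) := by
  let β : ContDiffBump (0 : V) := ⟨1, 2, one_pos, one_lt_two⟩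
  have hcs {v : V → ℝ} (hv : HasCompactSupport v) : HasCompactSupport fun x ↦ (v x : ℂ) :=
    hv.comp_left (g := ((↑) : ℝ → ℂ)) rfl
  have hcd {v : V → ℝ} (hv : ContDiff ℝ (⊤ : ℕ∞) v) :
      ContDiff ℝ (⊤ : ℕ∞) fun x ↦ (v x : ℂ) := Complex.ofRealCLM.contDiff.comp hv
  let M : 𝓢(V, ℂ) := (hcs β.hasCompactSupport).toSchwartzMap (hcd β.contDiff)
  have hMβ (ξ : V) : M ξ = β ξ := rfl
  refine ⟨𝓕 M, fun u hu hu' a q ε ha hq haq hε hav ↦ ?_⟩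
  let f : 𝓢(V, ℂ) := (hcs hu').toSchwartzMap (hcd hu)
  have hf (x : V) : f x = u x := rfl
  have key := lintegral_rpow_le_of_smoothing f
    (fun t ↦ 𝓕⁻ (smulLeftCLM ℂ (fun ξ ↦ M (t • ξ)) (𝓕 f))) ha hq hε ?_ ?_
  · rw [haq] at key
    simp only [hf, Complex.norm_real, Real.norm_eq_abs, Real.rpow_two] at key
    refine key.trans ?_
    gcongr ENNReal.ofReal _ * ?_
    exact lintegral_norm_sq_mul_fourier_sq (hu.differentiable (by simp)) hf
  · intro t ht x
    have := hav t ht x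
    rw [fourierInv_dilated_multiplier_apply f M ht x, Real.rpow_neg ht.le, ← div_eq_mul_inv,
      le_div_iff₀' (by positivity)]
    exact this
  · intro t ht ξ
    have hM : (fun ξ ↦ M (t • ξ)).HasTemperateGrowth := by fun_prop
    rw [FourierTransform.fourier_fourierInv_eq, smulLeftCLM_apply_apply hM, smul_eq_mul, hMβ]
    by_cases hξ : 1 < t * ‖ξ‖
    · rw [indicator_of_mem (show ξ ∈ {ξ | 1 < t * ‖ξ‖} from hξ), ← one_sub_mul, norm_mul,
        ← Complex.ofReal_one, ← Complex.ofReal_sub, Complex.norm_real,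
        Real.norm_of_nonneg (by linarith [β.le_one (x := t • ξ)])]
      exact mul_le_of_le_one_left (norm_nonneg _) (by linarith [β.nonneg (x := t • ξ)])
    · rw [indicator_of_notMem (show ξ ∉ {ξ | 1 < t * ‖ξ‖} from hξ), β.one_of_mem_closedBall]
      · simp
      · rw [mem_closedBall_zero_iff, norm_smul, Real.norm_of_nonneg ht.le]
        exact not_lt.1 hξ

end Smoothing

section Gradient

variable {V : Type*} [NormedAddCommGroup V] [InnerProductSpace ℝ V] [CompleteSpace V]

lemma continuous_gradient {u : V → ℝ} (hu : ContDiff ℝ 1 u) : Continuous (gradient u) :=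
  (InnerProductSpace.toDual ℝ V).symm.continuous.comp (hu.continuous_fderiv one_ne_zero)

lemma hasCompactSupport_gradient {u : V → ℝ} (hu : HasCompactSupport u) :
    HasCompactSupport (gradient u) :=
  (hu.fderiv ℝ).comp_left (map_zero (InnerProductSpace.toDual ℝ V).symm)

lemma norm_gradient (u : V → ℝ) (x : V) : ‖gradient u x‖ = ‖fderiv ℝ u x‖ :=
  (InnerProductSpace.toDual ℝ V).symm.norm_map _

end Gradient

section GradientIntegral

variable {V : Type*} [NormedAddCommGroup V] [InnerProductSpace ℝ V] [FiniteDimensional ℝ V]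
  [MeasurableSpace V] [BorelSpace V]

lemma integrable_norm_gradient_sq {u : V → ℝ} (hu : ContDiff ℝ 1 u) (hu' : HasCompactSupport u) :
    Integrable fun x ↦ ‖gradient u x‖ ^ 2 := by
  have h := continuous_gradient hu
  have hc : Continuous fun x ↦ ‖gradient u x‖ ^ 2 := by fun_prop
  have hs : HasCompactSupport fun x ↦ ‖gradient u x‖ ^ 2 :=
    (hasCompactSupport_gradient hu').comp_left (g := fun v : V ↦ ‖v‖ ^ 2) (by simp)
  exact hc.integrable_of_hasCompactSupport hs

lemma integral_norm_gradient_sq_le {u : V → ℝ} (hu : ContDiff ℝ 1 u) (hu' : HasCompactSupport u) :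
    ∫ x, ‖gradient u x‖ ^ 2 ≤ ∫ x, (‖gradient u x‖ ^ 2 + u x ^ 2) := by
  have h := hu.continuous
  have hc : Continuous fun x ↦ u x ^ 2 := by fun_prop
  have hs : HasCompactSupport fun x ↦ u x ^ 2 :=
    hu'.comp_left (g := fun s : ℝ ↦ s ^ 2) (by simp)
  have hi := integrable_norm_gradient_sq hu hu'
  exact integral_mono hi (hi.add (hc.integrable_of_hasCompactSupport hs))
    fun x ↦ le_add_of_nonneg_right (sq_nonneg _)

end GradientIntegral

section Compactness

/-- Functions bounded in `L^q`, `q > 1`, and tending to zero almost everywhere tend to zero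
weakly against bounded integrable weights. -/
lemma tendsto_integral_mul_zero_of_ae {α : Type*} [MeasurableSpace α] {μ : Measure α}
    {v : ℕ → α → ℝ} {K : α → ℂ} {B S q : ℝ} (hq : 1 < q) (hK : Integrable K μ)
    (hB0 : 0 ≤ B) (hB : ∀ z, ‖K z‖ ≤ B) (hv : ∀ k, AEStronglyMeasurable (v k) μ)
    (hvi : ∀ k, Integrable (fun z ↦ |v k z| ^ q) μ) (hS : ∀ k, ∫ z, |v k z| ^ q ∂μ ≤ S)
    (hae : ∀ᵐ z ∂μ, Tendsto (fun k ↦ v k z) atTop (𝓝 0)) :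
    Tendsto (fun k ↦ ∫ z, K z * (v k z : ℂ) ∂μ) atTop (𝓝 0) := by
  rw [tendsto_zero_iff_norm_tendsto_zero]
  refine tendsto_order.2 ⟨fun c hc ↦ .of_forall fun k ↦ hc.trans_le (norm_nonneg _),
    fun ε hε ↦ ?_⟩
  obtain ⟨R, hR, hRε⟩ : ∃ R : ℝ, 0 < R ∧ B * (R ^ (1 - q) * S) < ε / 2 := by
    have h : Tendsto (fun R : ℝ ↦ B * (R ^ (-(q - 1)) * S)) atTop (𝓝 (B * (0 * S))) :=
      ((tendsto_rpow_neg_atTop (by linarith)).mul_const S).const_mul B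
    rw [zero_mul, mul_zero] at h
    obtain ⟨R, hR, hR0⟩ := ((h.eventually_lt_const (half_pos hε)).and
      (eventually_gt_atTop 0)).exists
    exact ⟨R, hR0, by rwa [neg_sub] at hR⟩
  have hmin : Tendsto (fun k ↦ ∫ z, ‖K z‖ * min |v k z| R ∂μ) atTop (𝓝 0) := by
    have hlim := tendsto_integral_of_dominated_convergence
      (F := fun k z ↦ ‖K z‖ * min |v k z| R) (f := fun _ ↦ (0 : ℝ)) (μ := μ)
      (fun z ↦ ‖K z‖ * R)
      (fun k ↦ hK.1.norm.mul ((hv k).norm.inf aestronglyMeasurable_const)) (hK.norm.mul_const R)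
      (fun k ↦ .of_forall fun z ↦ by
        rw [Real.norm_of_nonneg (by positivity)]
        gcongr
        exact min_le_right _ _) ?_
    · simpa using hlim
    · filter_upwards [hae] with z hz
      have := ((hz.abs).min (tendsto_const_nhds (x := R))).const_mul ‖K z‖
      simpa [hR.le] using this
  have hpt (s : ℝ) : |s| ≤ min |s| R + R ^ (1 - q) * |s| ^ q := by
    rcases le_total |s| R with h | h
    · rw [min_eq_left h]
      have : 0 ≤ R ^ (1 - q) * |s| ^ q := by positivity
      linarith
    · have h0 : 0 < |s| := hR.trans_le h
      have h1 : |s| ^ (1 - q) * |s| ^ q = |s| := by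
        rw [← Real.rpow_add h0]; simp
      have h2 : |s| ^ (1 - q) ≤ R ^ (1 - q) :=
        Real.rpow_le_rpow_of_nonpos hR h (by linarith)
      have h3 : 0 ≤ min |s| R := by positivity
      have h4 := mul_le_mul_of_nonneg_right h2 (by positivity : 0 ≤ |s| ^ q)
      linarith
  filter_upwards [hmin.eventually_lt_const (half_pos hε)] with k hk
  have hi1 : Integrable (fun z ↦ ‖K z‖ * min |v k z| R) μ :=
    (hK.norm.mul_const R).mono' (hK.1.norm.mul ((hv k).norm.inf aestronglyMeasurable_const))
      (.of_forall fun z ↦ by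
        rw [Real.norm_of_nonneg (by positivity)]
        gcongr
        exact min_le_right _ _)
  have hi2 : Integrable (fun z ↦ B * (R ^ (1 - q) * |v k z| ^ q)) μ :=
    ((hvi k).const_mul _).const_mul _
  calc ‖∫ z, K z * (v k z : ℂ) ∂μ‖
      ≤ ∫ z, (‖K z‖ * min |v k z| R + B * (R ^ (1 - q) * |v k z| ^ q)) ∂μ := by
        refine norm_integral_le_of_norm_le (hi1.add hi2) (.of_forall fun z ↦ ?_)
        rw [norm_mul, Complex.norm_real, Real.norm_eq_abs]
        calc ‖K z‖ * |v k z| ≤ ‖K z‖ * (min |v k z| R + R ^ (1 - q) * |v k z| ^ q) := by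
              gcongr; exact hpt _
          _ ≤ _ := by
              rw [mul_add]
              gcongr
              exact hB z
    _ = (∫ z, ‖K z‖ * min |v k z| R ∂μ) + B * (R ^ (1 - q) * ∫ z, |v k z| ^ q ∂μ) := by
        rw [integral_add hi1 hi2, integral_const_mul, integral_const_mul]
    _ < ε := by
        have : B * (R ^ (1 - q) * ∫ z, |v k z| ^ q ∂μ) ≤ B * (R ^ (1 - q) * S) := by
          gcongr
          exact hS k
        linarith

variable {V : Type*} [NormedAddCommGroup V] [InnerProductSpace ℝ V] [FiniteDimensional ℝ V]
  [MeasurableSpace V] [BorelSpace V]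

lemma integrable_abs_rpow {u : V → ℝ} (hu : Continuous u) (hu' : HasCompactSupport u) {q : ℝ}
    (hq : 0 < q) : Integrable fun x ↦ |u x| ^ q := by
  refine Continuous.integrable_of_hasCompactSupport ?_ ?_
  · exact hu.abs.rpow_const fun _ ↦ .inr hq.le
  · exact hu'.comp_left (g := fun s ↦ |s| ^ q) (by simp [hq.ne'])

lemma integral_comp_add_smul (g : V → ℝ) (x : V) {t : ℝ} (ht : 0 < t) :
    ∫ z, g (x + t • z) = t ^ (-(Module.finrank ℝ V : ℝ)) * ∫ z, g z := by
  have h := Measure.integral_comp_smul volume (fun w ↦ g (x + w)) t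
  rw [abs_of_pos (by positivity), integral_add_left_eq_self g] at h
  rw [h, smul_eq_mul, Real.rpow_neg ht.le, Real.rpow_natCast]

/-- The Gagliardo-Nirenberg-Sobolev inequality, in terms of Bochner integrals. -/
lemma exists_integral_rpow_le_gradient (V : Type*) [NormedAddCommGroup V]
    [InnerProductSpace ℝ V] [FiniteDimensional ℝ V] [MeasurableSpace V] [BorelSpace V] {q : ℝ}
    (hV : 0 < Module.finrank ℝ V) (hq0 : 0 < q)
    (hq : q⁻¹ = 2⁻¹ - (Module.finrank ℝ V : ℝ)⁻¹) :
    ∃ S : ℝ, 0 ≤ S ∧ ∀ u : V → ℝ, ContDiff ℝ 1 u → HasCompactSupport u →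
      ∫ x, |u x| ^ q ≤ S * (∫ x, ‖gradient u x‖ ^ 2) ^ (q / 2) := by
  set c : ℝ≥0 := eLpNormLESNormFDerivOfEqInnerConst (volume : Measure V) (2 : ℝ≥0)
  refine ⟨(c : ℝ) ^ q, by positivity, fun u hu hu' ↦ ?_⟩
  lift q to ℝ≥0 using hq0.le
  have h : eLpNorm u q volume ≤ c * eLpNorm (fderiv ℝ u) (2 : ℝ≥0) volume :=
    eLpNorm_le_eLpNorm_fderiv_of_eq_inner (volume : Measure V) hu hu' (p := 2) (p' := q)
    one_le_two hV (by simpa using hq)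
  have hq0' : (q : ℝ≥0∞) ≠ 0 := by exact_mod_cast hq0.ne'
  rw [(hu.continuous.memLp_of_hasCompactSupport hu').eLpNorm_eq_integral_rpow_norm hq0' (by simp),
    ((hu.continuous_fderiv one_ne_zero).memLp_of_hasCompactSupport
      (hu'.fderiv ℝ)).eLpNorm_eq_integral_rpow_norm (by simp) (by simp),
    ← ENNReal.ofReal_coe_nnreal (p := c), ← ENNReal.ofReal_mul (by positivity),
    ENNReal.ofReal_le_ofReal_iff (by positivity)] at h
  simp only [ENNReal.coe_toReal, NNReal.coe_ofNat, Real.rpow_ofNat, Real.norm_eq_abs] at h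
  have h2 := Real.rpow_le_rpow (by positivity) h hq0.le
  rw [Real.rpow_inv_rpow (by positivity) hq0.ne', Real.mul_rpow (by positivity) (by positivity),
    ← Real.rpow_mul (by positivity), inv_mul_eq_div] at h2
  simpa only [norm_gradient] using h2

/-- Hölder's inequality for averages at scale `t` against a Schwartz kernel. -/
lemma exists_norm_average_le (K : 𝓢(V, ℂ)) {p : ℝ} (hp : 1 < p) :
    ∃ A : ℝ, 0 ≤ A ∧ ∀ u : V → ℝ, Continuous u → HasCompactSupport u → ∀ t, 0 < t → ∀ x,
      ‖∫ z, K z * (u (x + t • z) : ℂ)‖ ≤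
        A * (t ^ (-(Module.finrank ℝ V : ℝ) / p) * (∫ z, |u z| ^ p) ^ p⁻¹) := by
  have hpq : p.conjExponent.HolderConjugate p := (Real.HolderConjugate.conjExponent hp).symm
  refine ⟨(∫ z, ‖K z‖ ^ p.conjExponent) ^ (1 / p.conjExponent),
    by positivity, fun u hu hu' t ht x ↦ ?_⟩
  have hcont : Continuous fun z ↦ u (x + t • z) := by fun_prop
  have hcs : HasCompactSupport fun z ↦ u (x + t • z) :=
    hu'.comp_homeomorph ((Homeomorph.smulOfNeZero t ht.ne').trans (Homeomorph.addLeft x))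
  have h := integral_mul_norm_le_Lp_mul_Lq (μ := volume) (f := K)
    (g := fun z ↦ (u (x + t • z) : ℂ)) hpq (K.memLp _ _)
    (hcont.memLp_of_hasCompactSupport hcs).ofReal
  simp only [Complex.norm_real, Real.norm_eq_abs] at h
  rw [integral_comp_add_smul (fun z ↦ |u z| ^ p) x ht,
    Real.mul_rpow (by positivity) (by positivity), ← Real.rpow_mul ht.le, one_div p,
    ← div_eq_mul_inv] at h
  refine le_trans ?_ h
  refine (norm_integral_le_integral_norm _).trans_eq ?_
  simp [Complex.norm_real]

end Compactness

section Vanishing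

variable {V : Type*} [NormedAddCommGroup V] [InnerProductSpace ℝ V] [FiniteDimensional ℝ V]
  [MeasurableSpace V] [BorelSpace V]

/-- If the rescalings of `u k` at scales tending to zero vanish almost everywhere and `u k` tends
to zero in `L^p` for a subcritical `p`, then the averages of `u k` against a Schwartz kernel tend
to zero, uniformly over all centers and scales. -/
lemma eventually_average_le (K : 𝓢(V, ℂ)) (u : ℕ → V → ℝ) (hu : ∀ k, Continuous (u k))
    (hu' : ∀ k, HasCompactSupport (u k)) {a p q S : ℝ} (hp : 1 < p) (hq : 1 < q)
    (haq : a * q = Module.finrank ℝ V) (hap : a * p < Module.finrank ℝ V)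
    (hS : ∀ k, ∫ x, |u k x| ^ q ≤ S)
    (hnoconc : ∀ (y : ℕ → V) (t : ℕ → ℝ), (∀ k, 0 < t k) → Tendsto t atTop (𝓝 0) →
      ∀ᵐ ξ, Tendsto (fun k ↦ t k ^ a * u k (y k + t k • ξ)) atTop (𝓝 0))
    (hvan : Tendsto (fun k ↦ ∫ x, |u k x| ^ p) atTop (𝓝 0)) {ε : ℝ} (hε : 0 < ε) :
    ∀ᶠ k in atTop, ∀ t, 0 < t → ∀ x, t ^ a * ‖∫ z, K z * (u k (x + t • z) : ℂ)‖ ≤ ε := by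
  set n : ℝ := (Module.finrank ℝ V : ℝ)
  obtain ⟨A, hA0, hA⟩ := exists_norm_average_le K hp
  set b := n / p - a with hb
  have hb0 : 0 < b := by
    rw [hb, sub_pos, lt_div_iff₀ (by linarith)]
    exact hap
  set τ : ℕ → ℝ := fun k ↦ (A * (∫ z, |u k z| ^ p) ^ p⁻¹ / ε) ^ b⁻¹ with hτ
  have hτ0 : Tendsto τ atTop (𝓝 0) := by
    have h1 := hvan.rpow_const (p := p⁻¹) (.inr (by positivity))
    rw [Real.zero_rpow (by positivity)] at h1
    have h2 := ((h1.const_mul A).div_const ε).rpow_const (p := b⁻¹) (.inr (by positivity))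
    simpa [Real.zero_rpow (inv_ne_zero hb0.ne')] using h2
  have hτn (k : ℕ) : 0 ≤ τ k := by positivity
  have hsmall (k : ℕ) {t : ℝ} (ht : 0 < t) (x : V)
      (h : ε < t ^ a * ‖∫ z, K z * (u k (x + t • z) : ℂ)‖) : t ≤ τ k := by
    have h1 : ε < t ^ (-b) * (A * (∫ z, |u k z| ^ p) ^ p⁻¹) := by
      refine h.trans_le ((mul_le_mul_of_nonneg_left (hA (u k) (hu k) (hu' k) t ht x)
        (by positivity)).trans_eq ?_)
      rw [show -b = a + -n / p by rw [hb]; ring, Real.rpow_add ht]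
      ring
    rw [Real.rpow_neg ht.le, inv_mul_eq_div, lt_div_iff₀ (by positivity), mul_comm,
      ← lt_div_iff₀ hε] at h1
    have h2 := Real.rpow_le_rpow (by positivity) h1.le (inv_nonneg.2 hb0.le)
    rwa [Real.rpow_rpow_inv ht.le hb0.ne'] at h2
  have hchoose (k : ℕ) : ∃ (t : ℝ) (y : V), 0 < t ∧ t ≤ τ k + 1 / ((k : ℝ) + 1) ∧
      (t ^ a * ‖∫ z, K z * (u k (y + t • z) : ℂ)‖ ≤ ε →
        ∀ t, 0 < t → ∀ x, t ^ a * ‖∫ z, K z * (u k (x + t • z) : ℂ)‖ ≤ ε) := by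
    have hk : 0 < 1 / ((k : ℝ) + 1) := by positivity
    by_cases h : ∀ t, 0 < t → ∀ x, t ^ a * ‖∫ z, K z * (u k (x + t • z) : ℂ)‖ ≤ ε
    · exact ⟨1 / ((k : ℝ) + 1), 0, hk, by linarith [hτn k], fun _ ↦ h⟩
    · push Not at h
      obtain ⟨t, ht, y, hy⟩ := h
      exact ⟨t, y, ht, by linarith [hsmall k ht y hy], fun h ↦ absurd hy h.not_gt⟩
  choose t y ht htle hty using hchoose
  have ht0 : Tendsto t atTop (𝓝 0) := by
    refine squeeze_zero (fun k ↦ (ht k).le) htle ?_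
    simpa using hτ0.add (tendsto_one_div_add_atTop_nhds_zero_nat (𝕜 := ℝ))
  have hpow (k : ℕ) (ξ : V) : |t k ^ a * u k (y k + t k • ξ)| ^ q =
      t k ^ n * |u k (y k + t k • ξ)| ^ q := by
    have := (ht k).le
    rw [abs_mul, abs_of_nonneg (by positivity), Real.mul_rpow (by positivity) (by positivity),
      ← Real.rpow_mul this, haq]
  have hcont (k : ℕ) : Continuous fun ξ ↦ u k (y k + t k • ξ) := by
    have := hu k
    fun_prop
  obtain ⟨B, hB⟩ : ∃ B, ∀ z, ‖K z‖ ≤ B := ⟨_, K.toBoundedContinuousFunction.norm_coe_le_norm⟩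
  have hlim := tendsto_integral_mul_zero_of_ae (v := fun k ξ ↦ t k ^ a * u k (y k + t k • ξ))
    (S := S) hq K.integrable ((norm_nonneg _).trans (hB 0)) hB
    (fun k ↦ ((hcont k).const_smul (t k ^ a)).aestronglyMeasurable) ?_ ?_ (hnoconc y t ht ht0)
  · filter_upwards [hlim.norm.eventually_lt_const (by simpa using hε)] with k hk
    refine hty k (le_trans (le_of_eq ?_) hk.le)
    have : ∀ z, K z * ((t k ^ a * u k (y k + t k • z) : ℝ) : ℂ) =
        (t k ^ a : ℝ) • (K z * (u k (y k + t k • z) : ℂ)) := by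
      intro z
      rw [Complex.real_smul]
      push_cast
      ring
    simp_rw [this]
    rw [integral_smul, norm_smul, Real.norm_of_nonneg (Real.rpow_nonneg (ht k).le _)]
  · intro k
    simp_rw [hpow]
    refine Integrable.const_mul (integrable_abs_rpow (hcont k) ?_ (by linarith)) _
    exact (hu' k).comp_homeomorph
      ((Homeomorph.smulOfNeZero (t k) (ht k).ne').trans (Homeomorph.addLeft (y k)))
  · intro k
    simp_rw [hpow]
    rw [integral_const_mul, integral_comp_add_smul (fun x ↦ |u k x| ^ q) _ (ht k), ← mul_assoc,
      ← Real.rpow_add (ht k), add_neg_cancel, Real.rpow_zero, one_mul]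
    exact hS k

end Vanishing

end Auxiliary

/-- the vanishing lemma (Theorem 2.2 of the paper) in the case M = ℝ^N. -/
theorem struwe_solimini_stmt2 (N : ℕ) (hN : 3 ≤ N)
    (u : ℕ → EuclideanSpace ℝ (Fin N) → ℝ)
    (hsm : ∀ k, ContDiff ℝ (⊤ : ℕ∞) (u k)) (hsupp : ∀ k, HasCompactSupport (u k))
    (hbd : ∃ C : ℝ, ∀ k, (∫ x, (‖gradient (u k) x‖ ^ 2 + (u k x) ^ 2)) ≤ C)
    (hnoconc : ∀ (y : ℕ → EuclideanSpace ℝ (Fin N)) (t : ℕ → ℝ), (∀ k, 0 < t k) →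
      Tendsto t atTop (𝓝 0) →
      ∀ᵐ ξ : EuclideanSpace ℝ (Fin N),
        Tendsto (fun k => (t k) ^ (((N : ℝ) - 2) / 2) * u k (y k + t k • ξ)) atTop (𝓝 0))
    (p : ℝ) (hp1 : 2 < p) (hp2 : p < (2 * (N : ℝ)) / ((N : ℝ) - 2))
    (hvan : Tendsto (fun k => ∫ x, |u k x| ^ p) atTop (𝓝 0)) :
    Tendsto (fun k => ∫ x, |u k x| ^ ((2 * (N : ℝ)) / ((N : ℝ) - 2))) atTop (𝓝 0) := by
  have hN' : (3 : ℝ) ≤ N := by exact_mod_cast hN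
  have hN2 : 0 < (N : ℝ) - 2 := by linarith
  obtain ⟨C, hC⟩ := hbd
  set a : ℝ := ((N : ℝ) - 2) / 2 with ha
  set q : ℝ := 2 * (N : ℝ) / ((N : ℝ) - 2) with hq
  have ha0 : 0 < a := by positivity
  have hq2 : 2 < q := hp1.trans hp2
  have haq : a * q = N := by rw [ha, hq]; field_simp
  have hu1 (k : ℕ) : ContDiff ℝ 1 (u k) := (hsm k).of_le (by exact_mod_cast le_top)
  have hgi (k : ℕ) := integrable_norm_gradient_sq (hu1 k) (hsupp k)
  have hgC (k : ℕ) : ∫ x, ‖gradient (u k) x‖ ^ 2 ≤ C :=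
    (integral_norm_gradient_sq_le (hu1 k) (hsupp k)).trans (hC k)
  obtain ⟨S, hS0, hS⟩ := exists_integral_rpow_le_gradient (EuclideanSpace ℝ (Fin N)) (q := q)
    (by rw [finrank_euclideanSpace_fin]; omega) (by linarith)
    (by rw [finrank_euclideanSpace_fin, hq]; field_simp)
  have hSC (k : ℕ) : ∫ x, |u k x| ^ q ≤ S * C ^ (q / 2) := by
    refine (hS (u k) (hu1 k) (hsupp k)).trans ?_
    gcongr
    · exact hgC k
  obtain ⟨K, hK⟩ := exists_kernel_lintegral_rpow_le (EuclideanSpace ℝ (Fin N))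
  have hC0 : 0 ≤ C := (integral_nonneg fun x ↦ by positivity).trans (hgC 0)
  have hbound {ε : ℝ} (hε : 0 < ε) : ∀ᶠ k in atTop,
      ∫ x, |u k x| ^ q ≤ 4 * q / (q - 2) * (2 * ε) ^ (q - 2) * C := by
    filter_upwards [eventually_average_le K u (fun k ↦ (hsm k).continuous) hsupp (by linarith)
      (by linarith) (by simpa using haq)
      (by rw [finrank_euclideanSpace_fin, ← haq]; gcongr) hSC hnoconc hvan hε] with k hk
    have h := hK (u k) (hsm k) (hsupp k) a q ε ha0 hq2 (by rw [mul_sub, haq, ha]; ring) hε hk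
    have hc : 0 ≤ 4 * q / (q - 2) * (2 * ε) ^ (q - 2) :=
      mul_nonneg (div_nonneg (by linarith) (by linarith)) (by positivity)
    rw [← ofReal_integral_eq_lintegral_ofReal
        (integrable_abs_rpow (hsm k).continuous (hsupp k) (by linarith))
        (.of_forall fun _ ↦ by positivity),
      ← ofReal_integral_eq_lintegral_ofReal (hgi k) (.of_forall fun _ ↦ by positivity),
      ← ENNReal.ofReal_mul hc, ENNReal.ofReal_le_ofReal_iff
        (mul_nonneg hc (integral_nonneg fun _ ↦ by positivity))] at h
    exact h.trans (mul_le_mul_of_nonneg_left (hgC k) hc)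
  refine tendsto_order.2 ⟨fun c hc ↦ .of_forall fun k ↦
    hc.trans_le (integral_nonneg fun x ↦ by positivity), fun δ hδ ↦ ?_⟩
  have hlim : Tendsto (fun ε : ℝ ↦ 4 * q / (q - 2) * (2 * ε) ^ (q - 2) * C) (𝓝[>] 0) (𝓝 0) := by
    have h : ContinuousAt (fun ε : ℝ ↦ 4 * q / (q - 2) * (2 * ε) ^ (q - 2) * C) 0 := by
      refine ContinuousAt.mul (continuousAt_const.mul ?_) continuousAt_const
      exact ContinuousAt.rpow_const (by fun_prop) (.inr (by linarith))
    have h' := h.tendsto.mono_left (nhdsWithin_le_nhds (s := Set.Ioi 0))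
    simpa [Real.zero_rpow (by linarith : q - 2 ≠ 0)] using h'
  obtain ⟨ε, hεδ, hε⟩ := ((hlim.eventually_lt_const hδ).and self_mem_nhdsWithin).exists
  exact (hbound hε).mono fun k hk ↦ hk.trans_lt hεδ
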